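/- Let d ≥ 1, let 1 ≤ p < ∞, and let φ be an admissible weight of growth rate μ ∈ [0,1) with constant c ≥ 1. Then there exist constants C₁, C₂ > 0, depending only on d, p, μ and c, such that for every measurable function u : ℝ^d → ℝ one has C₁ · sup_{x̄ ∈ ℝ^d} φ(x̄) ∫_{ℝ^d} |u(x)|^p e^{−|x−x̄|} dx ≤ sup_{z ∈ (ℤ/2)^d} φ(z) ∫_{C(z)} |u(x)|^p dx ≤ C₂ · sup_{x̄ ∈ ℝ^d} φ(x̄) ∫_{ℝ^d} |u(x)|^p e^{−|x−x̄|} dx (suprema taken in [0,∞]). -/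

import Mathlib

open MeasureTheory ENNReal Real

noncomputable section

/-- The closed unit cube of `ℝ^d` centered at `z`. -/
def cube (d : ℕ) (z : EuclideanSpace ℝ (Fin d)) : Set (EuclideanSpace ℝ (Fin d)) :=
  {x | ∀ i, |x i - z i| ≤ 1 / 2}

/-- The half-integer lattice point associated to `ι : Fin d → ℤ`. -/
def latticePt (d : ℕ) (ι : Fin d → ℤ) : EuclideanSpace ℝ (Fin d) :=
  WithLp.toLp 2 (fun i => (ι i : ℝ) / 2)

/-- A sum over functions `Fin d → α` of products of one-variable terms factors as a power. -/
theorem ENNReal.tsum_pi_prod_eq_pow {α : Type*} (f : α → ℝ≥0∞) (d : ℕ) :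
    ∑' ι : Fin d → α, ∏ i, f (ι i) = (∑' a, f a) ^ d := by
  induction d with
  | zero => simp
  | succ d ih =>
    rw [← (Fin.consEquiv fun _ : Fin (d + 1) => α).tsum_eq, ENNReal.tsum_prod']
    simp only [Fin.consEquiv_apply, Fin.prod_univ_succ, Fin.cons_zero, Fin.cons_succ,
      ENNReal.tsum_mul_left, ih, ENNReal.tsum_mul_right]
    rw [pow_succ']

theorem summable_exp_neg_mul_abs_int {b : ℝ} (hb : 0 < b) :
    Summable fun n : ℤ => Real.exp (-(b * |(n : ℝ)|)) := by
  have h : Summable fun n : ℕ => Real.exp (-(b * (n : ℝ))) := by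
    have := Real.summable_exp_nat_mul_iff.mpr (neg_lt_zero.mpr hb)
    refine this.congr fun n => ?_
    congr 1
    ring
  apply Summable.of_nat_of_neg <;> simpa using h

theorem latticePt_sub (d : ℕ) (ι κ : Fin d → ℤ) :
    latticePt d (ι - κ) = latticePt d ι - latticePt d κ := by
  ext i
  simp [latticePt, sub_div]

theorem tsum_exp_neg_mul_norm_latticePt_ne_top {d : ℕ} (hd : 1 ≤ d) {a : ℝ} (ha : 0 < a) :
    ∑' ι : Fin d → ℤ, ENNReal.ofReal (Real.exp (-(a * ‖latticePt d ι‖))) ≠ ∞ := by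
  have hd0 : (0 : ℝ) < d := by exact_mod_cast hd
  have hb : 0 < a / (2 * d) := by positivity
  have hfin : (∑' n : ℤ, ENNReal.ofReal (Real.exp (-(a / (2 * d) * |(n : ℝ)|)))) ^ d ≠ ∞ :=
    ENNReal.pow_ne_top (summable_exp_neg_mul_abs_int hb).tsum_ofReal_ne_top
  rw [← ENNReal.tsum_pi_prod_eq_pow] at hfin
  refine ne_top_of_le_ne_top hfin (ENNReal.tsum_le_tsum fun ι => ?_)
  rw [← ENNReal.ofReal_prod_of_nonneg fun i _ => (Real.exp_pos _).le, ← Real.exp_sum,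
    Finset.sum_neg_distrib, ← Finset.mul_sum]
  refine ENNReal.ofReal_le_ofReal (Real.exp_le_exp.mpr (neg_le_neg ?_))
  have hsum : ∑ i, |(ι i : ℝ)| ≤ 2 * d * ‖latticePt d ι‖ := by
    calc ∑ i, |(ι i : ℝ)| ≤ ∑ _i : Fin d, 2 * ‖latticePt d ι‖ := by
          refine Finset.sum_le_sum fun i _ => ?_
          have h := PiLp.norm_apply_le (latticePt d ι) i
          simp only [latticePt, Real.norm_eq_abs, abs_div, Nat.abs_ofNat] at h ⊢
          linarith
      _ = 2 * d * ‖latticePt d ι‖ := by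
          simp only [Finset.sum_const, Finset.card_univ, Fintype.card_fin, nsmul_eq_mul]
          ring
  calc a / (2 * d) * ∑ i, |(ι i : ℝ)| ≤ a / (2 * d) * (2 * d * ‖latticePt d ι‖) := by gcongr
    _ = a * ‖latticePt d ι‖ := by field_simp

theorem norm_sub_le_of_mem_cube {d : ℕ} {x z : EuclideanSpace ℝ (Fin d)} (hx : x ∈ cube d z) :
    ‖x - z‖ ≤ d := by
  rw [EuclideanSpace.norm_eq, Real.sqrt_le_left (by positivity)]
  calc ∑ i, ‖(x - z) i‖ ^ 2 ≤ ∑ _i : Fin d, (1 : ℝ) := by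
        refine Finset.sum_le_sum fun i _ => ?_
        have h := hx i
        rw [PiLp.sub_apply, Real.norm_eq_abs]
        nlinarith [abs_nonneg (x i - z i)]
    _ = d := by simp
    _ ≤ (d : ℝ) ^ 2 := by
        have h : d ≤ d ^ 2 := Nat.le_self_pow two_ne_zero d
        exact_mod_cast h

theorem exists_mem_cube_latticePt {d : ℕ} (x : EuclideanSpace ℝ (Fin d)) :
    ∃ ι : Fin d → ℤ, x ∈ cube d (latticePt d ι) := by
  refine ⟨fun i => round (2 * x i), fun i => ?_⟩
  have h := abs_le.mp (abs_sub_round (2 * x i))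
  simp only [latticePt]
  exact abs_le.mpr ⟨by linarith, by linarith⟩

theorem measurableSet_cube {d : ℕ} (z : EuclideanSpace ℝ (Fin d)) : MeasurableSet (cube d z) := by
  have h : IsClosed (cube d z) := by
    simp only [cube, Set.ofPred_forall]
    exact isClosed_iInter fun i => isClosed_le (by fun_prop) continuous_const
  exact h.measurableSet

/-- A weighted integral with exponential kernel is at most a sum of weighted integrals over the
lattice cubes, with exponentially decaying coefficients. -/
theorem weight_mul_lintegral_exp_le_tsum {d : ℕ} {μ : ℝ} (hμ0 : 0 ≤ μ) (hμ1 : μ ≤ 1)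
    {c : ℝ} (hc : 0 ≤ c) {φ : EuclideanSpace ℝ (Fin d) → ℝ} (hφ : ∀ x, 0 < φ x)
    (hφc : ∀ x y, φ x ≤ c * Real.exp (μ * ‖x - y‖) * φ y)
    {g : EuclideanSpace ℝ (Fin d) → ℝ} (hg : ∀ x, 0 ≤ g x)
    (xb : EuclideanSpace ℝ (Fin d)) {κ : Fin d → ℤ} (hκ : xb ∈ cube d (latticePt d κ)) :
    ENNReal.ofReal (φ xb) * ∫⁻ x, ENNReal.ofReal (g x * Real.exp (-‖x - xb‖)) ≤
      ∑' ι : Fin d → ℤ, ENNReal.ofReal (c * Real.exp (2 * d)) *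
        ENNReal.ofReal (Real.exp (-((1 - μ) * ‖latticePt d (ι - κ)‖))) *
        (ENNReal.ofReal (φ (latticePt d ι)) *
          ∫⁻ x in cube d (latticePt d ι), ENNReal.ofReal (g x)) := by
  have hcover : (⋃ ι : Fin d → ℤ, cube d (latticePt d ι)) = Set.univ :=
    Set.eq_univ_of_forall fun x => Set.mem_iUnion.mpr (exists_mem_cube_latticePt x)
  rw [← setLIntegral_univ, ← hcover]
  refine (mul_le_mul_right (lintegral_iUnion_le _ _) _).trans ?_
  rw [← ENNReal.tsum_mul_left]
  refine ENNReal.tsum_le_tsum fun ι => ?_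
  have hz := latticePt_sub d ι κ
  set z := latticePt d ι
  rw [hz, ← mul_assoc, ← ENNReal.ofReal_mul (by positivity), ← ENNReal.ofReal_mul (by positivity),
    ← lintegral_const_mul' _ _ ENNReal.ofReal_ne_top,
    ← lintegral_const_mul' _ _ ENNReal.ofReal_ne_top]
  refine setLIntegral_mono' (measurableSet_cube _) fun x hx => ?_
  rw [← ENNReal.ofReal_mul (hφ _).le,
    ← ENNReal.ofReal_mul (mul_nonneg (by positivity) (hφ _).le)]
  refine ENNReal.ofReal_le_ofReal ?_
  have hxz := norm_sub_le_of_mem_cube hx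
  have hxk := norm_sub_le_of_mem_cube hκ
  have htri : ‖xb - z‖ ≤ ‖x - xb‖ + ‖x - z‖ := by
    simpa [norm_sub_rev] using norm_sub_le_norm_sub_add_norm_sub xb x z
  have htri' : ‖z - latticePt d κ‖ ≤ ‖xb - z‖ + ‖xb - latticePt d κ‖ := by
    simpa [norm_sub_rev] using norm_sub_le_norm_sub_add_norm_sub z xb (latticePt d κ)
  have hexp : μ * ‖xb - z‖ + -‖x - xb‖ ≤ 2 * d + -((1 - μ) * ‖z - latticePt d κ‖) := by
    have hmul : (1 - μ) * ‖z - latticePt d κ‖ ≤ (1 - μ) * (‖xb - z‖ + d) :=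
      mul_le_mul_of_nonneg_left (by linarith) (by linarith)
    nlinarith [mul_nonneg hμ0 (Nat.cast_nonneg (α := ℝ) d)]
  calc φ xb * (g x * Real.exp (-‖x - xb‖))
      ≤ c * Real.exp (μ * ‖xb - z‖) * φ z * (g x * Real.exp (-‖x - xb‖)) :=
        mul_le_mul_of_nonneg_right (hφc xb z) (mul_nonneg (hg x) (Real.exp_pos _).le)
    _ = c * Real.exp (μ * ‖xb - z‖ + -‖x - xb‖) * φ z * g x := by
        rw [Real.exp_add]
        ring
    _ ≤ c * Real.exp (2 * d + -((1 - μ) * ‖z - latticePt d κ‖)) * φ z * g x := by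
        have := hφ z
        have := hg x
        gcongr
    _ = _ := by
        rw [Real.exp_add]
        ring

theorem weight_mul_setLIntegral_cube_le {d : ℕ} (φ : EuclideanSpace ℝ (Fin d) → ℝ)
    {g : EuclideanSpace ℝ (Fin d) → ℝ} (hg : ∀ x, 0 ≤ g x) (z : EuclideanSpace ℝ (Fin d)) :
    ENNReal.ofReal (φ z) * ∫⁻ x in cube d z, ENNReal.ofReal (g x) ≤
      ENNReal.ofReal (Real.exp d) *
        (ENNReal.ofReal (φ z) * ∫⁻ x, ENNReal.ofReal (g x * Real.exp (-‖x - z‖))) := by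
  rw [mul_left_comm,
    ← lintegral_const_mul' (ENNReal.ofReal (Real.exp d)) _ ENNReal.ofReal_ne_top]
  refine mul_le_mul_right (le_trans ?_ (setLIntegral_le_lintegral (cube d z) _)) _
  refine setLIntegral_mono' (measurableSet_cube _) fun x hx => ?_
  rw [← ENNReal.ofReal_mul (by positivity), mul_left_comm, ← Real.exp_add]
  refine ENNReal.ofReal_le_ofReal (le_mul_of_one_le_right (hg x) (Real.one_le_exp ?_))
  linarith [norm_sub_le_of_mem_cube hx]

/-- The `p`-th power analogue: `L^p_{b,φ}(ℝ^d)` and `L̃^p_{b,φ}(ℝ^d)` coincide,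
with equivalence constants depending only on `d`, `p`, `μ` and `c`. -/
theorem statement1 (d : ℕ) (hd : 1 ≤ d) (p : ℝ) (hp : 1 ≤ p)
    (μ : ℝ) (hμ0 : 0 ≤ μ) (hμ1 : μ < 1) (c : ℝ) (hc : 1 ≤ c) :
    ∃ C₁ C₂ : ℝ, 0 < C₁ ∧ 0 < C₂ ∧
      ∀ φ : EuclideanSpace ℝ (Fin d) → ℝ, Measurable φ →
        (∃ B : ℝ, ∀ x, φ x ≤ B) → (∀ x, 0 < φ x) →
        (∀ x y : EuclideanSpace ℝ (Fin d),
            c⁻¹ * Real.exp (-μ * ‖x - y‖) ≤ φ x / φ y ∧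
            φ x / φ y ≤ c * Real.exp (μ * ‖x - y‖)) →
        ∀ u : EuclideanSpace ℝ (Fin d) → ℝ, Measurable u →
          ENNReal.ofReal C₁ *
              (⨆ xb : EuclideanSpace ℝ (Fin d), ENNReal.ofReal (φ xb) *
                ∫⁻ x, ENNReal.ofReal (|u x| ^ p * Real.exp (-‖x - xb‖))) ≤
            (⨆ ι : Fin d → ℤ, ENNReal.ofReal (φ (latticePt d ι)) *
              ∫⁻ x in cube d (latticePt d ι), ENNReal.ofReal (|u x| ^ p)) ∧
          (⨆ ι : Fin d → ℤ, ENNReal.ofReal (φ (latticePt d ι)) *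
              ∫⁻ x in cube d (latticePt d ι), ENNReal.ofReal (|u x| ^ p)) ≤
            ENNReal.ofReal C₂ *
              (⨆ xb : EuclideanSpace ℝ (Fin d), ENNReal.ofReal (φ xb) *
                ∫⁻ x, ENNReal.ofReal (|u x| ^ p * Real.exp (-‖x - xb‖))) := by
  set K := ∑' ι : Fin d → ℤ, ENNReal.ofReal (Real.exp (-((1 - μ) * ‖latticePt d ι‖))) with hK
  have hKtop : K ≠ ∞ := tsum_exp_neg_mul_norm_latticePt_ne_top hd (by linarith)
  have hK0 : K ≠ 0 := by
    intro h
    have h0 := ENNReal.tsum_eq_zero.mp h 0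
    rw [ENNReal.ofReal_eq_zero] at h0
    exact absurd h0 (not_le.mpr (Real.exp_pos _))
  have hc0 : 0 < c := by linarith
  have hM : 0 < c * Real.exp (2 * d) * K.toReal :=
    mul_pos (by positivity) (ENNReal.toReal_pos hK0 hKtop)
  refine ⟨(c * Real.exp (2 * d) * K.toReal)⁻¹, Real.exp d, inv_pos.mpr hM, Real.exp_pos _, ?_⟩
  intro φ _ _ hφ hφc u _
  have hg : ∀ x, 0 ≤ |u x| ^ p := fun x => by positivity
  constructor
  · rw [ENNReal.ofReal_inv_of_pos hM, ENNReal.inv_mul_le_iff (ENNReal.ofReal_pos.mpr hM).ne'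
      ENNReal.ofReal_ne_top, ENNReal.ofReal_mul (by positivity), ENNReal.ofReal_toReal hKtop]
    refine iSup_le fun xb => ?_
    obtain ⟨κ, hκ⟩ := exists_mem_cube_latticePt xb
    refine (weight_mul_lintegral_exp_le_tsum hμ0 hμ1.le hc0.le hφ
      (fun x y => (div_le_iff₀ (hφ y)).mp (hφc x y).2) hg xb hκ).trans ?_
    rw [hK, ← (Equiv.subRight κ).tsum_eq (fun ι : Fin d → ℤ =>
      ENNReal.ofReal (Real.exp (-((1 - μ) * ‖latticePt d ι‖)))),
      ← ENNReal.tsum_mul_left, ← ENNReal.tsum_mul_right]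
    exact ENNReal.tsum_le_tsum fun ι => mul_le_mul_right
      (le_iSup (fun ι : Fin d → ℤ => ENNReal.ofReal (φ (latticePt d ι)) *
        ∫⁻ x in cube d (latticePt d ι), ENNReal.ofReal (|u x| ^ p)) ι) _
  · refine iSup_le fun ι => (weight_mul_setLIntegral_cube_le φ hg _).trans ?_
    exact mul_le_mul_right (le_iSup (fun xb : EuclideanSpace ℝ (Fin d) => ENNReal.ofReal (φ xb) *
      ∫⁻ x, ENNReal.ofReal (|u x| ^ p * Real.exp (-‖x - xb‖))) _) _
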